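/- arXiv:2506.01754 — 4 statements merged into one kernel-verified Lean document; each statement's English description precedes it below -/
import Mathlib

section
/- Let N ≥ 1, let m be a natural number, and fix a known input u ∈ ℝ^m and time t. Suppose for each i ∈ {1,…,N} the function f_{i1} : ℝ^N × ℝ^m × ℝ^N → ℝ depends on its last argument b only through the components b_j with j < i (i.e., if b and b' agree on all coordinates j < i then f_{i1}(y,u,b) = f_{i1}(y,u,b')), and suppose g_i(y,u,t) > 0 for all arguments. Then the observability map O : ℝ^N × ℝ^N → ℝ^N × ℝ^N defined by O(a,b) = (a, (f_{11}(a,u,b) + g_1(a,u,t)·b_1, …, f_{N1}(a,u,b) + g_N(a,u,t)·b_N)) is bijective. (This is the strong-observability Proposition 1: the state x can be recovered from (y, ẏ) independently of the unknown inputs.) -/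
/-- A map of the form `b ↦ (φ i b + c i * b i)ᵢ`, where `c i ≠ 0` and `φ i b` depends only on the
coordinates of `b` preceding `i`, is injective. -/
theorem triangular_map_injective {K : Type*} [Field K] {N : ℕ} {φ : Fin N → (Fin N → K) → K}
    {c : Fin N → K}
    (hφ : ∀ (i : Fin N) (b b' : Fin N → K), (∀ j < i, b j = b' j) → φ i b = φ i b')
    (hc : ∀ i, c i ≠ 0) :
    Function.Injective (fun (b : Fin N → K) (i : Fin N) => φ i b + c i * b i) := by
  intro b b' h
  funext i
  induction i using WellFoundedLT.induction with
  | ind i ih =>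
    have hi : φ i b + c i * b i = φ i b' + c i * b' i := congrFun h i
    rw [hφ i b b' ih] at hi
    exact mul_left_cancel₀ (hc i) (add_left_cancel hi)

/-- A map of the form `b ↦ (φ i b + c i * b i)ᵢ`, where `c i ≠ 0` and `φ i b` depends only on the
coordinates of `b` preceding `i`, is surjective. -/
theorem triangular_map_surjective {K : Type*} [Field K] {N : ℕ} {φ : Fin N → (Fin N → K) → K}
    {c : Fin N → K}
    (hφ : ∀ (i : Fin N) (b b' : Fin N → K), (∀ j < i, b j = b' j) → φ i b = φ i b')
    (hc : ∀ i, c i ≠ 0) :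
    Function.Surjective (fun (b : Fin N → K) (i : Fin N) => φ i b + c i * b i) := by
  intro z
  have solve_prefix : ∀ k ≤ N, ∃ b : Fin N → K,
      ∀ i : Fin N, (i : ℕ) < k → φ i b + c i * b i = z i := by
    intro k
    induction k with
    | zero => exact fun _ => ⟨0, fun i hi => absurd hi (Nat.not_lt_zero _)⟩
    | succ k ih =>
      intro hk
      obtain ⟨b, hb⟩ := ih (Nat.le_of_succ_le hk)
      let l : Fin N := ⟨k, hk⟩
      let b' := Function.update b l ((z l - φ l b) / c l)
      have agree : ∀ j < l, b' j = b j := fun j hj => Function.update_of_ne hj.ne _ _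
      refine ⟨b', fun i hi => ?_⟩
      rcases Nat.lt_succ_iff_lt_or_eq.mp hi with hlt | heq
      · have hil : i < l := hlt
        rw [hφ i b' b fun j hj => agree j (hj.trans hil), agree i hil]
        exact hb i hlt
      · obtain rfl : i = l := Fin.ext heq
        rw [hφ l b' b agree, show b' l = (z l - φ l b) / c l from Function.update_self _ _ _,
          mul_div_cancel₀ _ (hc l)]
        ring
  obtain ⟨b, hb⟩ := solve_prefix N le_rfl
  exact ⟨b, funext fun i => hb i i.isLt⟩

/-- Proposition 1, strong observability.
For `N ≥ 1` subsystems with cascaded interconnection (each `f i` depends on its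
last argument `b` only through components `b j` with `j < i`) and strictly
positive gains `g i`, the observability map
`O (a, b) = (a, fun i => f i a u b + g i a u t * b i)` is bijective. -/
theorem observability_map_bijective
    (N m : ℕ) (hN : 1 ≤ N)
    (u : Fin m → ℝ) (t : ℝ)
    (f : Fin N → (Fin N → ℝ) → (Fin m → ℝ) → (Fin N → ℝ) → ℝ)
    (g : Fin N → (Fin N → ℝ) → (Fin m → ℝ) → ℝ → ℝ)
    (hf : ∀ (i : Fin N) (y : Fin N → ℝ) (b b' : Fin N → ℝ),
      (∀ j : Fin N, (j : ℕ) < (i : ℕ) → b j = b' j) → f i y u b = f i y u b')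
    (hg : ∀ (i : Fin N) (y : Fin N → ℝ), 0 < g i y u t) :
    Function.Bijective
      (fun p : (Fin N → ℝ) × (Fin N → ℝ) =>
        ((p.1, fun i : Fin N => f i p.1 u p.2 + g i p.1 u t * p.2 i) :
          (Fin N → ℝ) × (Fin N → ℝ))) := by
  have hdep (y : Fin N → ℝ) (i : Fin N) (b b' : Fin N → ℝ) (h : ∀ j < i, b j = b' j) :
      f i y u b = f i y u b' := hf i y b b' h
  have hne (y : Fin N → ℝ) (i : Fin N) : g i y u t ≠ 0 := (hg i y).ne'
  constructor
  · rintro ⟨a, b⟩ ⟨a', b'⟩ h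
    obtain ⟨rfl, h⟩ := Prod.mk.inj h
    exact Prod.ext rfl (triangular_map_injective (hdep a) (hne a) h)
  · rintro ⟨y, z⟩
    obtain ⟨b, hb⟩ := triangular_map_surjective (hdep y) (hne y) z
    exact ⟨(y, b), Prod.ext rfl hb⟩
end

section
/- Let P and Q be symmetric positive definite 2×2 real matrices, let λ_min(Q) denote the smallest eigenvalue of Q and λ_max(P) the largest eigenvalue of P. Let g_m > 0, γ > 0, 0 < η < 1, and let g ≥ g_m be a real number. Then for every ξ ∈ ℝ² and every ρ ∈ ℝ satisfying ‖ξ‖ ≥ 2λ_max(P)|ρ| / ((1−η)·γ·g_m·λ_min(Q)), one has −γ·g·ξᵀQξ + 2ρ·(Pξ)₁ ≤ −η·γ·g_m·λ_min(Q)·‖ξ‖², where (Pξ)₁ denotes the first component of Pξ and ‖·‖ is the Euclidean norm. -/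
open Matrix

open scoped InnerProductSpace

namespace Matrix.IsHermitian

variable {n : Type*} [Fintype n] [DecidableEq n] {A : Matrix n n ℝ}

lemma inner_eigenvectorBasis_mulVec (hA : A.IsHermitian) (i : n) (x : EuclideanSpace ℝ n) :
    ⟪hA.eigenvectorBasis i, WithLp.toLp 2 (A *ᵥ x.ofLp)⟫_ℝ =
      hA.eigenvalues i * ⟪hA.eigenvectorBasis i, x⟫_ℝ := by
  have hT : Aᵀ = A := by simpa using hA.eq
  simp only [EuclideanSpace.inner_eq_star_dotProduct, star_trivial]
  rw [dotProduct_comm, dotProduct_mulVec, ← mulVec_transpose, hT, hA.mulVec_eigenvectorBasis,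
    smul_dotProduct, smul_eq_mul, dotProduct_comm]

/-- Rayleigh lower bound: a lower bound on the eigenvalues bounds the quadratic form below. -/
lemma mul_norm_sq_le_dotProduct_mulVec (hA : A.IsHermitian) {c : ℝ}
    (hc : ∀ i, c ≤ hA.eigenvalues i) (x : EuclideanSpace ℝ n) :
    c * ‖x‖ ^ 2 ≤ x.ofLp ⬝ᵥ A *ᵥ x.ofLp := by
  have h : x.ofLp ⬝ᵥ A *ᵥ x.ofLp = ⟪x, WithLp.toLp 2 (A *ᵥ x.ofLp)⟫_ℝ := by
    simp [EuclideanSpace.inner_eq_star_dotProduct, dotProduct_comm]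
  rw [h, ← hA.eigenvectorBasis.sum_inner_mul_inner, ← hA.eigenvectorBasis.sum_sq_norm_inner_right x,
    Finset.mul_sum]
  refine Finset.sum_le_sum fun i _ => ?_
  rw [hA.inner_eigenvectorBasis_mulVec, real_inner_comm, Real.norm_eq_abs, sq_abs]
  nlinarith [mul_le_mul_of_nonneg_right (hc i) (sq_nonneg ⟪x, hA.eigenvectorBasis i⟫_ℝ)]

/-- A bound on the absolute values of the eigenvalues bounds the Euclidean operator norm. -/
lemma norm_mulVec_le (hA : A.IsHermitian) {c : ℝ} (hc₀ : 0 ≤ c)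
    (hc : ∀ i, |hA.eigenvalues i| ≤ c) (x : EuclideanSpace ℝ n) :
    ‖WithLp.toLp 2 (A *ᵥ x.ofLp)‖ ≤ c * ‖x‖ := by
  refine le_of_sq_le_sq ?_ (by positivity)
  rw [mul_pow, ← hA.eigenvectorBasis.sum_sq_norm_inner_right,
    ← hA.eigenvectorBasis.sum_sq_norm_inner_right x, Finset.mul_sum]
  refine Finset.sum_le_sum fun i _ => ?_
  rw [hA.inner_eigenvectorBasis_mulVec, norm_mul, mul_pow, Real.norm_eq_abs]
  gcongr
  exact hc i

lemma exists_mulVec_eq_eigenvalues_smul (hA : A.IsHermitian) (i : n) :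
    ∃ v : n → ℝ, v ≠ 0 ∧ A *ᵥ v = hA.eigenvalues i • v :=
  ⟨hA.eigenvectorBasis i, fun h => hA.eigenvectorBasis.orthonormal.ne_zero i
    (WithLp.ofLp_injective 2 h), hA.mulVec_eigenvectorBasis i⟩

end Matrix.IsHermitian

lemma Matrix.PosDef.pos_of_mulVec_eq_smul {n : Type*} [Fintype n] {A : Matrix n n ℝ}
    (hA : A.PosDef) {r : ℝ} {v : n → ℝ} (hv : v ≠ 0) (h : A *ᵥ v = r • v) : 0 < r := by
  have h1 := hA.dotProduct_mulVec_pos hv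
  rw [h, dotProduct_smul, smul_eq_mul] at h1
  exact pos_of_mul_pos_left h1 (dotProduct_star_self_nonneg v)

/-- Key pointwise Lyapunov-derivative inequality: with
`λ_min(Q)` the smallest eigenvalue of the symmetric positive definite `Q`,
`λ_max(P)` the largest eigenvalue of the symmetric positive definite `P`,
`g ≥ g_m > 0`, `γ > 0` and `0 < η < 1`, for all `ξ ∈ ℝ²` and `ρ ∈ ℝ` with
`‖ξ‖ ≥ 2λ_max(P)|ρ|/((1−η)γ g_m λ_min(Q))` one has
`−γ g ξᵀQξ + 2ρ(Pξ)₁ ≤ −η γ g_m λ_min(Q) ‖ξ‖²`. -/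
theorem lyapunov_bracket_inequality
    (P Q : Matrix (Fin 2) (Fin 2) ℝ)
    (hPsymm : P.IsSymm) (hPpos : P.PosDef)
    (hQsymm : Q.IsSymm) (hQpos : Q.PosDef)
    (lminQ lmaxP : ℝ)
    (hlmin : IsLeast {r : ℝ | ∃ v : Fin 2 → ℝ, v ≠ 0 ∧ Q.mulVec v = r • v} lminQ)
    (hlmax : IsGreatest {r : ℝ | ∃ v : Fin 2 → ℝ, v ≠ 0 ∧ P.mulVec v = r • v} lmaxP)
    (g_m γ η g : ℝ) (hgm : 0 < g_m) (hγ : 0 < γ)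
    (hη₀ : 0 < η) (hη₁ : η < 1) (hg : g_m ≤ g) :
    ∀ (ξ : EuclideanSpace ℝ (Fin 2)) (ρ : ℝ),
      ‖ξ‖ ≥ 2 * lmaxP * |ρ| / ((1 - η) * γ * g_m * lminQ) →
      -(γ * g * ((ξ : Fin 2 → ℝ) ⬝ᵥ Q.mulVec (ξ : Fin 2 → ℝ)))
          + 2 * ρ * (P.mulVec (ξ : Fin 2 → ℝ) 0)
        ≤ -(η * γ * g_m * lminQ * ‖ξ‖ ^ 2) := by
  intro ξ ρ hξ
  have hl : 0 < lminQ := by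
    obtain ⟨v, hv, h⟩ := hlmin.1
    exact hQpos.pos_of_mulVec_eq_smul hv h
  have hL : 0 < lmaxP := by
    obtain ⟨v, hv, h⟩ := hlmax.1
    exact hPpos.pos_of_mulVec_eq_smul hv h
  have hQξ := hQpos.isHermitian.mul_norm_sq_le_dotProduct_mulVec
    (fun i => hlmin.2 (hQpos.isHermitian.exists_mulVec_eq_eigenvalues_smul i)) ξ
  have hPξ : |(P *ᵥ ξ.ofLp) 0| ≤ lmaxP * ‖ξ‖ :=
    (PiLp.norm_apply_le (WithLp.toLp 2 (P *ᵥ ξ.ofLp)) 0).trans <|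
      hPpos.isHermitian.norm_mulVec_le hL.le (fun i => by
        rw [abs_of_pos (hPpos.eigenvalues_pos i)]
        exact hlmax.2 (hPpos.isHermitian.exists_mulVec_eq_eigenvalues_smul i)) ξ
  have hη : 0 < 1 - η := sub_pos.2 hη₁
  rw [ge_iff_le, div_le_iff₀ (by positivity)] at hξ
  have hdrift : γ * g_m * (lminQ * ‖ξ‖ ^ 2) ≤ γ * g * (ξ.ofLp ⬝ᵥ Q *ᵥ ξ.ofLp) := by
    gcongr
    exact mul_nonneg hγ.le (hgm.le.trans hg)
  have hpert : ρ * (P *ᵥ ξ.ofLp) 0 ≤ |ρ| * (lmaxP * ‖ξ‖) :=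
    (le_abs_self _).trans (by rw [abs_mul]; gcongr)
  have hball := mul_le_mul_of_nonneg_right hξ (norm_nonneg ξ)
  linarith
end

section
/- Let μ₁, μ₂ > 0, φ₁(z) = μ₁|z|^{1/2}·sign(z) + μ₂z and φ₁'(z) = (μ₁/2)|z|^{-1/2} + μ₂ for z ≠ 0. Then for every real z ≠ 0 and every ξ ∈ ℝ² whose first component equals φ₁(z), one has φ₁'(z)·‖ξ‖ ≥ μ₁²/2 + μ₂·‖ξ‖, where ‖·‖ is the Euclidean norm. Consequently φ₁'(z)·‖ξ‖² ≥ (μ₁²/2)·‖ξ‖ + μ₂·‖ξ‖². -/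
/-- The linear correction `μ₂ z` has the sign of `z`, so it can only increase the modulus of the
generalized super-twisting injection. -/
lemma mul_rpow_abs_le_abs_gst {μ₁ μ₂ : ℝ} (hμ₂ : 0 ≤ μ₂) (p : ℝ) {z : ℝ} (hz : z ≠ 0) :
    μ₁ * |z| ^ p ≤ |μ₁ * |z| ^ p * Real.sign z + μ₂ * z| := by
  rcases hz.lt_or_gt with hneg | hpos
  · rw [Real.sign_of_neg hneg]
    refine le_trans ?_ (neg_le_abs _)
    linarith [mul_nonneg hμ₂ (neg_nonneg.mpr hneg.le)]
  · rw [Real.sign_of_pos hpos]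
    refine le_trans ?_ (le_abs_self _)
    linarith [mul_nonneg hμ₂ hpos.le]

/-- For `μ₁, μ₂ > 0`, `φ₁ z = μ₁|z|^{1/2} sign z + μ₂ z`
and `φ₁' z = (μ₁/2)|z|^{-1/2} + μ₂` (`z ≠ 0`): for every `z ≠ 0` and every
`ξ ∈ ℝ²` whose first component equals `φ₁ z`, one has
`φ₁'(z)·‖ξ‖ ≥ μ₁²/2 + μ₂‖ξ‖`, and consequently
`φ₁'(z)·‖ξ‖² ≥ (μ₁²/2)‖ξ‖ + μ₂‖ξ‖²`. -/
theorem phi1'_norm_lower_bound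
    (μ₁ μ₂ : ℝ) (hμ₁ : 0 < μ₁) (hμ₂ : 0 < μ₂)
    (φ₁ φ₁' : ℝ → ℝ)
    (hφ₁ : ∀ z : ℝ, φ₁ z = μ₁ * |z| ^ ((1 : ℝ)/2) * Real.sign z + μ₂ * z)
    (hφ₁' : ∀ z : ℝ, z ≠ 0 → φ₁' z = μ₁ / 2 * |z| ^ (-(1 : ℝ)/2) + μ₂) :
    ∀ (z : ℝ), z ≠ 0 → ∀ ξ : EuclideanSpace ℝ (Fin 2), ξ 0 = φ₁ z →
      φ₁' z * ‖ξ‖ ≥ μ₁ ^ 2 / 2 + μ₂ * ‖ξ‖ ∧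
      φ₁' z * ‖ξ‖ ^ 2 ≥ μ₁ ^ 2 / 2 * ‖ξ‖ + μ₂ * ‖ξ‖ ^ 2 := by
  intro z hz ξ hξ
  have hs : 0 < |z| ^ ((1 : ℝ) / 2) := Real.rpow_pos_of_pos (abs_pos.mpr hz) _
  have hφ_le : μ₁ * |z| ^ ((1 : ℝ) / 2) ≤ ‖ξ‖ :=
    calc μ₁ * |z| ^ ((1 : ℝ) / 2)
        ≤ |φ₁ z| := hφ₁ z ▸ mul_rpow_abs_le_abs_gst hμ₂.le _ hz
      _ = ‖ξ 0‖ := by rw [hξ, Real.norm_eq_abs]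
      _ ≤ ‖ξ‖ := PiLp.norm_apply_le ξ 0
  have hinv : |z| ^ (-(1 : ℝ) / 2) = (|z| ^ ((1 : ℝ) / 2))⁻¹ := by
    rw [neg_div, Real.rpow_neg (abs_nonneg z)]
  have hlin : μ₁ ^ 2 / 2 + μ₂ * ‖ξ‖ ≤ φ₁' z * ‖ξ‖ := by
    have hμ_le : μ₁ ≤ (|z| ^ ((1 : ℝ) / 2))⁻¹ * ‖ξ‖ := by
      rwa [inv_mul_eq_div, le_div_iff₀ hs]
    rw [hφ₁' z hz, hinv]
    linarith [mul_le_mul_of_nonneg_left hμ_le (half_pos hμ₁).le]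
  exact ⟨hlin, by linarith [mul_le_mul_of_nonneg_right hlin (norm_nonneg ξ)]⟩
end

section
/- Let t₀ ∈ ℝ, c > 0, and let V : ℝ → ℝ be a nonnegative function that is continuous on [t₀, ∞) and differentiable on (t₀, ∞), whose derivative satisfies V'(t) ≤ −c·√(V(t)) for all t ∈ (t₀, ∞). Then V(t) = 0 for every t ≥ t₀ + 2√(V(t₀))/c. -/
/-- finite-time comparison principle. If a nonnegative
function `V`, continuous on `[t₀, ∞)` and differentiable on `(t₀, ∞)`,
satisfies `V' t ≤ −c√(V t)` on `(t₀, ∞)` with `c > 0`, then `V t = 0` for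
every `t ≥ t₀ + 2√(V t₀)/c`. -/
theorem finite_time_comparison
    (t₀ c : ℝ) (hc : 0 < c) (V : ℝ → ℝ)
    (hV0 : ∀ t : ℝ, 0 ≤ V t)
    (hcont : ContinuousOn V (Set.Ici t₀))
    (hdiff : ∀ t ∈ Set.Ioi t₀, DifferentiableAt ℝ V t)
    (hderiv : ∀ t ∈ Set.Ioi t₀, deriv V t ≤ -c * Real.sqrt (V t)) :
    ∀ t : ℝ, t₀ + 2 * Real.sqrt (V t₀) / c ≤ t → V t = 0 := by
  intro t ht
  have hanti : AntitoneOn V (Set.Ici t₀) := by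
    refine antitoneOn_of_deriv_nonpos (convex_Ici t₀) hcont ?_ ?_ <;> rw [interior_Ici]
    · exact fun s hs => (hdiff s hs).differentiableWithinAt
    · intro s hs
      have := mul_nonneg hc.le (Real.sqrt_nonneg (V s))
      linarith [hderiv s hs]
  have ht₀ : t₀ ≤ t := by
    have : 0 ≤ 2 * Real.sqrt (V t₀) / c := by positivity
    linarith
  by_contra hne
  have hVt : 0 < V t := lt_of_le_of_ne (hV0 t) (Ne.symm hne)
  have hpos : ∀ s ∈ Set.Icc t₀ t, 0 < V s := fun s hs =>
    hVt.trans_le (hanti hs.1 ht₀ hs.2)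
  have hsqrt : ∀ s ∈ Set.Ioo t₀ t, HasDerivAt (fun s => Real.sqrt (V s) + c / 2 * s)
      (deriv V s / (2 * Real.sqrt (V s)) + c / 2 * 1) s := fun s hs =>
    ((hdiff s hs.1).hasDerivAt.sqrt (hpos s ⟨hs.1.le, hs.2.le⟩).ne').add
      ((hasDerivAt_id s).const_mul (c / 2))
  have hdecay : AntitoneOn (fun s => Real.sqrt (V s) + c / 2 * s) (Set.Icc t₀ t) := by
    refine antitoneOn_of_deriv_nonpos (convex_Icc t₀ t) ?_ ?_ ?_
    · exact (hcont.mono Set.Icc_subset_Ici_self).sqrt.add (by fun_prop)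
    · rw [interior_Icc]
      exact fun s hs => (hsqrt s hs).differentiableAt.differentiableWithinAt
    · rw [interior_Icc]
      intro s hs
      rw [(hsqrt s hs).deriv]
      have hr : 0 < Real.sqrt (V s) := Real.sqrt_pos.2 (hpos s ⟨hs.1.le, hs.2.le⟩)
      have : deriv V s / (2 * Real.sqrt (V s)) ≤ -(c / 2) := by
        rw [div_le_iff₀ (by positivity)]
        linarith [hderiv s hs.1]
      linarith
  have hle := hdecay (Set.left_mem_Icc.2 ht₀) (Set.right_mem_Icc.2 ht₀) ht₀
  have hbound : 2 * Real.sqrt (V t₀) ≤ (t - t₀) * c := by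
    rw [← div_le_iff₀ hc]
    linarith
  have := Real.sqrt_pos.2 hVt
  dsimp only at hle
  linarith
end
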